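/- arXiv:2112.07255 — 5 statements merged into one kernel-verified Lean document; each statement's English description precedes it below -/
import Mathlib

section
/- There is no deterministic strategy-proof mechanism for 2 agents and 4 indivisible goods with additive valuations that outputs a complete EFX allocation for every profile of reported valuations. That is, if a mechanism f maps every pair of additive valuations over 4 goods to a complete allocation that is EFX with respect to the reported valuations, then there exist a valuation profile, an agent i, and a misreport by agent i under which agent i's true value of its bundle strictly increases. -/
/-- The bundle of goods assigned to agent `i` by the complete allocation `A`
(which assigns each good to exactly one agent). -/
def bundle {n m : ℕ} (A : Fin m → Fin n) (i : Fin n) : Finset (Fin m) :=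
  Finset.univ.filter fun g => A g = i

/-- Additive value of a set of goods given per-good values. -/
def val {m : ℕ} (v : Fin m → ℝ) (S : Finset (Fin m)) : ℝ := ∑ g ∈ S, v g

/-- An allocation is EFX: for all agents `i, j` and every good `a ∈ A_j`,
`v_i(A_i) ≥ v_i(A_j \ {a})`. -/
def IsEFX {n m : ℕ} (v : Fin n → Fin m → ℝ) (A : Fin m → Fin n) : Prop :=
  ∀ i j : Fin n, ∀ a ∈ bundle A j,
    val (v i) (bundle A i) ≥ val (v i) ((bundle A j).erase a)

/-- Additive value of a set of goods given natural-number values of the goods. -/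
def natVal {m : ℕ} (w : Fin m → ℕ) (S : Finset (Fin m)) : ℕ := ∑ g ∈ S, w g

/-- The real valuation profile obtained from a natural-number one. -/
def castProfile {n m : ℕ} (w : Fin n → Fin m → ℕ) : Fin n → Fin m → ℝ := fun i g => w i g

/-- `IsEFX` for natural-number valuations, in a form that can be decided. -/
abbrev IsNatEFX {n m : ℕ} (w : Fin n → Fin m → ℕ) (A : Fin m → Fin n) : Prop :=
  ∀ i j : Fin n, ∀ a ∈ bundle A j,
    natVal (w i) ((bundle A j).erase a) ≤ natVal (w i) (bundle A i)

theorem val_castProfile {n m : ℕ} (w : Fin n → Fin m → ℕ) (i : Fin n) (S : Finset (Fin m)) :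
    val (castProfile w i) S = natVal (w i) S := by
  simp [val, castProfile, natVal]

theorem isEFX_castProfile {n m : ℕ} {w : Fin n → Fin m → ℕ} {A : Fin m → Fin n} :
    IsEFX (castProfile w) A ↔ IsNatEFX w A := by
  simp [IsEFX, IsNatEFX, val_castProfile]

theorem update_castProfile {n m : ℕ} (w : Fin n → Fin m → ℕ) (i : Fin n) (u : Fin m → ℕ) :
    Function.update (castProfile w) i (fun g => (u g : ℝ)) =
      castProfile (Function.update w i u) := by
  ext j g
  by_cases h : j = i
  · subst h; simp [castProfile]
  · simp [castProfile, h]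

theorem seven_le_of_isNatEFX : ∀ A : Fin 4 → Fin 2, IsNatEFX ![![4, 0, 1, 2], ![3, 2, 0, 2]] A →
    7 ≤ natVal ![0, 4, 1, 3] (bundle A 1) := by
  decide

theorem le_five_of_isNatEFX : ∀ A : Fin 4 → Fin 2, IsNatEFX ![![4, 0, 1, 2], ![0, 4, 1, 3]] A →
    7 ≤ natVal ![0, 4, 1, 3] (bundle A 1) → natVal ![4, 0, 1, 2] (bundle A 0) ≤ 5 := by
  decide

theorem five_le_of_isNatEFX : ∀ A : Fin 4 → Fin 2, IsNatEFX ![![4, 2, 0, 2], ![3, 4, 0, 2]] A →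
    5 ≤ natVal ![0, 4, 1, 3] (bundle A 1) := by
  decide

theorem le_five_of_isNatEFX_of_le_five : ∀ A : Fin 4 → Fin 2,
    IsNatEFX ![![4, 2, 0, 2], ![0, 4, 1, 3]] A → 5 ≤ natVal ![0, 4, 1, 3] (bundle A 1) →
      natVal ![4, 0, 1, 2] (bundle A 0) ≤ 5 → natVal ![4, 2, 0, 2] (bundle A 0) ≤ 5 := by
  decide

theorem six_le_of_isNatEFX : ∀ A : Fin 4 → Fin 2, IsNatEFX ![![3, 4, 0, 3], ![0, 4, 1, 3]] A →
    natVal ![4, 0, 1, 2] (bundle A 0) ≤ 5 → 6 ≤ natVal ![4, 2, 0, 2] (bundle A 0) := by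
  decide

/-- There is no deterministic strategy-proof mechanism for 2 agents and 4 goods
with additive (nonnegative) valuations that always outputs a complete EFX
allocation: any mechanism whose output is EFX w.r.t. every reported profile
admits a profile, an agent `i`, and a misreport under which agent `i`'s true
value of its bundle strictly increases. -/
theorem no_strategyproof_EFX_mechanism_two_agents_four_goods
    (f : (Fin 2 → Fin 4 → ℝ) → (Fin 4 → Fin 2))
    (hEFX : ∀ v : Fin 2 → Fin 4 → ℝ, (∀ i g, 0 ≤ v i g) → IsEFX v (f v)) :
    ∃ v : Fin 2 → Fin 4 → ℝ, (∀ i g, 0 ≤ v i g) ∧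
      ∃ (i : Fin 2) (v' : Fin 4 → ℝ), (∀ g, 0 ≤ v' g) ∧
        val (v i) (bundle (f (Function.update v i v')) i) >
          val (v i) (bundle (f v) i) := by
  by_contra! h
  have nonneg : ∀ w : Fin 2 → Fin 4 → ℕ, ∀ i g, 0 ≤ castProfile w i g := fun w i g =>
    Nat.cast_nonneg (w i g)
  have efx : ∀ w, IsNatEFX w (f (castProfile w)) := fun w =>
    isEFX_castProfile.1 (hEFX _ (nonneg w))
  have sp : ∀ w i u, natVal (w i) (bundle (f (castProfile (Function.update w i u))) i) ≤
      natVal (w i) (bundle (f (castProfile w)) i) := by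
    intro w i u
    have := h (castProfile w) (nonneg w) i (fun g => (u g : ℝ)) fun g => Nat.cast_nonneg (u g)
    rw [update_castProfile, val_castProfile, val_castProfile] at this
    exact_mod_cast this
  have sp_fst : ∀ p r q, natVal p (bundle (f (castProfile ![r, q])) 0) ≤
      natVal p (bundle (f (castProfile ![p, q])) 0) := by
    intro p r q
    have : Function.update ![p, q] 0 r = ![r, q] := by ext i; fin_cases i <;> simp
    simpa [this] using sp ![p, q] 0 r
  have sp_snd : ∀ p q s, natVal q (bundle (f (castProfile ![p, s])) 1) ≤
      natVal q (bundle (f (castProfile ![p, q])) 1) := by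
    intro p q s
    have : Function.update ![p, q] 1 s = ![p, s] := by ext i; fin_cases i <;> simp
    simpa [this] using sp ![p, q] 1 s
  -- When the second agent reports `(0, 4, 1, 3)`, every bundle on offer to the first agent is
  -- worth at most 5 under `(4, 0, 1, 2)`.
  have menu : ∀ p, natVal ![4, 0, 1, 2] (bundle (f (castProfile ![p, ![0, 4, 1, 3]])) 0) ≤ 5 :=
    fun p => (sp_fst _ p _).trans <| le_five_of_isNatEFX _ (efx _) <|
      (seven_le_of_isNatEFX _ (efx _)).trans (sp_snd _ _ _)
  have upper : natVal ![4, 2, 0, 2]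
      (bundle (f (castProfile ![![4, 2, 0, 2], ![0, 4, 1, 3]])) 0) ≤ 5 :=
    le_five_of_isNatEFX_of_le_five _ (efx _)
      ((five_le_of_isNatEFX _ (efx _)).trans (sp_snd _ _ _)) (menu _)
  have lower : 6 ≤ natVal ![4, 2, 0, 2]
      (bundle (f (castProfile ![![4, 2, 0, 2], ![0, 4, 1, 3]])) 0) :=
    (six_le_of_isNatEFX _ (efx _) (menu _)).trans (sp_fst _ _ _)
  omega
end

section
/- There is no deterministic strategy-proof mechanism for 2 agents and 3 indivisible goods with additive valuations that outputs a proportional complete allocation whenever the reported profile admits one. That is, if a mechanism f maps every pair of additive valuations over 3 goods to a complete allocation, and f(v) is proportional with respect to v for every profile v that admits a proportional allocation, then there exist a profile, an agent i, and a misreport by agent i under which agent i's true value of its bundle strictly increases. -/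
/-- An allocation for `n` agents is proportional: every agent's value for its
own bundle is at least a `1/n` fraction of its value for all the goods. -/
def IsProportional {n m : ℕ} (v : Fin n → Fin m → ℝ) (A : Fin m → Fin n) : Prop :=
  ∀ i : Fin n, val (v i) (bundle A i) ≥ val (v i) Finset.univ / n

@[simp]
lemma cons_val_two_three {α : Type*} (a b c : α) : ![a, b, c] 2 = c := rfl

/-- The value of a bundle of three goods, written good by good. -/
lemma val_bundle_three {n : ℕ} (w : Fin 3 → ℝ) (A : Fin 3 → Fin n) (i : Fin n) :
    val w (bundle A i) = (if A 0 = i then w 0 else 0) + (if A 1 = i then w 1 else 0) +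
      (if A 2 = i then w 2 else 0) := by
  simp [val, bundle, Finset.sum_filter, Fin.sum_univ_three]

/-- Proportionality for two agents and three goods, written good by good. -/
lemma isProportional_two_three_iff (v : Fin 2 → Fin 3 → ℝ) (A : Fin 3 → Fin 2) :
    IsProportional v A ↔ ∀ i : Fin 2, (v i 0 + v i 1 + v i 2) / 2 ≤
      (if A 0 = i then v i 0 else 0) + (if A 1 = i then v i 1 else 0) +
        (if A 2 = i then v i 2 else 0) := by
  simp only [IsProportional, val_bundle_three, ge_iff_le]
  simp [val, Fin.sum_univ_three]

lemma Fin.eq_zero_or_one_of_two (x : Fin 2) : x = 0 ∨ x = 1 := by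
  fin_cases x <;> simp

/-- There is no deterministic strategy-proof mechanism for 2 agents and 3 goods
with additive (nonnegative) valuations that outputs a proportional complete
allocation whenever the reported profile admits one: any mechanism whose output
is proportional w.r.t. every reported profile admitting a proportional
allocation has a profile, an agent `i`, and a misreport under which agent `i`'s
true value of its bundle strictly increases. -/
theorem no_strategyproof_proportional_mechanism_two_agents_three_goods
    (f : (Fin 2 → Fin 3 → ℝ) → (Fin 3 → Fin 2))
    (hProp : ∀ v : Fin 2 → Fin 3 → ℝ, (∀ i g, 0 ≤ v i g) →
      (∃ A : Fin 3 → Fin 2, IsProportional v A) → IsProportional v (f v)) :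
    ∃ v : Fin 2 → Fin 3 → ℝ, (∀ i g, 0 ≤ v i g) ∧
      ∃ (i : Fin 2) (v' : Fin 3 → ℝ), (∀ g, 0 ≤ v' g) ∧
        val (v i) (bundle (f (Function.update v i v')) i) >
          val (v i) (bundle (f v) i) := by
  -- Each agent has its own majority good; whoever misses good 2 gains by reporting equal values.
  have hdisj : f ![![3, 1, 1], ![1, 3, 1]] 0 = 0 ∧ f ![![3, 1, 1], ![1, 3, 1]] 1 = 1 := by
    have h := hProp ![![3, 1, 1], ![1, 3, 1]] (by simp [Fin.forall_fin_succ])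
      ⟨![0, 1, 1], by rw [isProportional_two_three_iff]; norm_num [Fin.forall_fin_two]⟩
    rw [isProportional_two_three_iff] at h
    revert h
    generalize f ![![3, 1, 1], ![1, 3, 1]] = A
    rcases Fin.eq_zero_or_one_of_two (A 0) with h0 | h0 <;>
    rcases Fin.eq_zero_or_one_of_two (A 1) with h1 | h1 <;>
    rcases Fin.eq_zero_or_one_of_two (A 2) with h2 | h2 <;>
    norm_num [Fin.forall_fin_two, h0, h1, h2]
  have hleft : f ![![1, 1, 1], ![1, 3, 1]] = ![0, 1, 0] := by
    have h := hProp ![![1, 1, 1], ![1, 3, 1]] (by simp [Fin.forall_fin_succ])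
      ⟨![0, 1, 0], by rw [isProportional_two_three_iff]; norm_num [Fin.forall_fin_two]⟩
    rw [isProportional_two_three_iff] at h
    revert h
    generalize f ![![1, 1, 1], ![1, 3, 1]] = A
    rcases Fin.eq_zero_or_one_of_two (A 0) with h0 | h0 <;>
    rcases Fin.eq_zero_or_one_of_two (A 1) with h1 | h1 <;>
    rcases Fin.eq_zero_or_one_of_two (A 2) with h2 | h2 <;>
    norm_num [Fin.forall_fin_two, funext_iff, Fin.forall_fin_succ, h0, h1, h2]
  have hright : f ![![3, 1, 1], ![1, 1, 1]] = ![0, 1, 1] := by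
    have h := hProp ![![3, 1, 1], ![1, 1, 1]] (by simp [Fin.forall_fin_succ])
      ⟨![0, 1, 1], by rw [isProportional_two_three_iff]; norm_num [Fin.forall_fin_two]⟩
    rw [isProportional_two_three_iff] at h
    revert h
    generalize f ![![3, 1, 1], ![1, 1, 1]] = A
    rcases Fin.eq_zero_or_one_of_two (A 0) with h0 | h0 <;>
    rcases Fin.eq_zero_or_one_of_two (A 1) with h1 | h1 <;>
    rcases Fin.eq_zero_or_one_of_two (A 2) with h2 | h2 <;>
    norm_num [Fin.forall_fin_two, funext_iff, Fin.forall_fin_succ, h0, h1, h2]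
  obtain ⟨h0, h1⟩ := hdisj
  refine ⟨![![3, 1, 1], ![1, 3, 1]], by simp [Fin.forall_fin_succ], ?_⟩
  rcases Fin.eq_zero_or_one_of_two (f ![![3, 1, 1], ![1, 3, 1]] 2) with h2 | h2
  · refine ⟨1, ![1, 1, 1], by simp [Fin.forall_fin_succ], ?_⟩
    have hu : Function.update ![![3, 1, 1], ![1, 3, 1]] 1 ![1, 1, 1] =
        (![![3, 1, 1], ![1, 1, 1]] : Fin 2 → Fin 3 → ℝ) := by
      ext i j; fin_cases i <;> simp
    rw [hu, hright, val_bundle_three, val_bundle_three, h0, h1, h2]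
    norm_num
  · refine ⟨0, ![1, 1, 1], by simp [Fin.forall_fin_succ], ?_⟩
    have hu : Function.update ![![3, 1, 1], ![1, 3, 1]] 0 ![1, 1, 1] =
        (![![1, 1, 1], ![1, 3, 1]] : Fin 2 → Fin 3 → ℝ) := by
      ext i j; fin_cases i <;> simp
    rw [hu, hleft, val_bundle_three, val_bundle_three, h0, h1, h2]
    norm_num
end

section
/- Repeated serial dictatorship (round-robin picking) is Nash strategy-proof for identical additive valuations: let n agents share a common true additive valuation v over m goods, and run round-robin picking in the fixed agent order 1,...,n repeated cyclically, where on its turn an agent is allocated the remaining good with the highest value according to its own reported valuation (ties broken by a fixed order on goods). If all agents other than agent i report v truthfully, then for every misreport v'_i of agent i, the value under v of the bundle agent i receives when reporting v is at least the value under v of the bundle agent i receives when reporting v'_i. -/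
/-- From a list of remaining goods (listed in the fixed tie-breaking order),
pick the first good with maximum value under `w` (`none` if the list is empty). -/
noncomputable def pickBest {G : Type*} (w : G → ℝ) : List G → Option G
  | [] => none
  | g :: rest =>
    match pickBest w rest with
    | none => some g
    | some g' => if w g' > w g then some g' else some g

/-- Run a picking sequence: `turns` is the list of agents' turns, `R` the list
of remaining goods in the fixed tie-breaking order.  On its turn, an agent is
allocated the remaining good with the highest value under its reported
valuation, ties broken in favour of goods earlier in the fixed order.  Returns
the bundle each agent ends up with. -/
noncomputable def pickingRun {I G : Type*} [DecidableEq I] [DecidableEq G]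
    (v : I → G → ℝ) : List I → List G → I → Finset G
  | [], _ => fun _ => ∅
  | i :: ts, R =>
    match pickBest (v i) R with
    | none => fun _ => ∅
    | some g => fun j => (if j = i then {g} else ∅) ∪ pickingRun v ts (R.erase g) j

/-- Round-robin picking for `n` agents and `m` goods: the agent order
`0, 1, …, n-1` is repeated cyclically until all `m` goods are allocated. -/
noncomputable def roundRobin {n m : ℕ} (hn : 0 < n)
    (v : Fin n → Fin m → ℝ) : Fin n → Finset (Fin m) :=
  pickingRun v ((List.range m).map fun t => (⟨t % n, Nat.mod_lt t hn⟩ : Fin n))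
    (List.finRange m)

theorem pickBest_eq_none {G : Type*} {w : G → ℝ} {R : List G} (h : pickBest w R = none) :
    R = [] := by
  cases R with
  | nil => rfl
  | cons g rest =>
    simp only [pickBest] at h
    split at h
    · simp at h
    · split_ifs at h

theorem pickBest_eq_some {G : Type*} {w : G → ℝ} {R : List G} {g : G}
    (h : pickBest w R = some g) : g ∈ R ∧ ∀ x ∈ R, w x ≤ w g := by
  induction R generalizing g with
  | nil => simp [pickBest] at h
  | cons a rest ih =>
    simp only [pickBest] at h
    split at h
    · rename_i hnone
      obtain rfl := pickBest_eq_none hnone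
      simp_all
    · rename_i g' hsome
      obtain ⟨hmem, hmax⟩ := ih hsome
      split_ifs at h with hlt
      · obtain rfl : g' = g := by simpa using h
        refine ⟨List.mem_cons_of_mem _ hmem, fun x hx => ?_⟩
        rcases List.mem_cons.1 hx with rfl | hx
        · exact hlt.le
        · exact hmax x hx
      · obtain rfl : a = g := by simpa using h
        refine ⟨List.mem_cons_self, fun x hx => ?_⟩
        rcases List.mem_cons.1 hx with rfl | hx
        · exact le_rfl
        · exact (hmax x hx).trans (not_lt.1 hlt)

theorem mem_of_mem_pickingRun {I G : Type*} [DecidableEq I] [DecidableEq G]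
    {v : I → G → ℝ} {ts : List I} {R : List G} {j : I} {x : G}
    (h : x ∈ pickingRun v ts R j) : x ∈ R := by
  induction ts generalizing R with
  | nil => simp [pickingRun] at h
  | cons t ts ih =>
    cases hg : pickBest (v t) R with
    | none => simp [pickingRun, hg] at h
    | some g =>
      simp only [pickingRun, hg] at h
      rcases Finset.mem_union.1 h with h | h
      · split_ifs at h
        · rw [Finset.mem_singleton.1 h]
          exact (pickBest_eq_some hg).1
        · simp at h
      · exact List.mem_of_mem_erase (ih h)

/-- The value of an agent's bundle splits into the value of the good picked on the first turn
and the value of the goods picked later. -/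
theorem sum_pickingRun_cons {I G : Type*} [DecidableEq I] [DecidableEq G]
    {v : I → G → ℝ} (w : G → ℝ) {t : I} (ts : List I) {R : List G} (hR : R.Nodup) (j : I)
    {g : G} (hg : pickBest (v t) R = some g) :
    ∑ x ∈ pickingRun v (t :: ts) R j, w x =
      (if j = t then w g else 0) + ∑ x ∈ pickingRun v ts (R.erase g) j, w x := by
  simp only [pickingRun, hg]
  split_ifs with hj
  · rw [Finset.sum_union, Finset.sum_singleton]
    rw [Finset.disjoint_singleton_left]
    exact fun h => hR.not_mem_erase (mem_of_mem_pickingRun h)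
  · simp

/-- The total of the entries of a list of values that fall on the turns of agent `i`. -/
noncomputable def turnValue {I : Type*} [DecidableEq I] (i : I) : List I → List ℝ → ℝ
  | t :: ts, a :: l => (if i = t then a else 0) + turnValue i ts l
  | _, _ => 0

/-- Replacing an entry of a decreasing list of values by a smaller one (and re-sorting) lowers the
total on the turns of `i`, by at most the difference of the two entries. -/
theorem turnValue_orderedInsert {I : Type*} [DecidableEq I] (i : I) (ts : List I) {l : List ℝ}
    (hl : l.Pairwise (· ≥ ·)) {x y : ℝ} (hyx : y ≤ x) :
    turnValue i ts (l.orderedInsert (· ≥ ·) y) ≤ turnValue i ts (l.orderedInsert (· ≥ ·) x) ∧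
    turnValue i ts (l.orderedInsert (· ≥ ·) x) ≤
      turnValue i ts (l.orderedInsert (· ≥ ·) y) + (x - y) := by
  induction ts generalizing l x y with
  | nil => simp [turnValue, hyx]
  | cons t ts ih =>
    cases l with
    | nil =>
      simp only [List.orderedInsert, turnValue]
      split_ifs <;> constructor <;> linarith
    | cons c l =>
      have hl' := (List.pairwise_cons.1 hl).2
      have hc : l.orderedInsert (· ≥ ·) c = c :: l := by
        cases l with
        | nil => rfl
        | cons d l =>
          exact List.orderedInsert_cons_of_le _ _ ((List.pairwise_cons.1 hl).1 d (by simp))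
      by_cases hx : x ≥ c
      · by_cases hy : y ≥ c
        · simp only [List.orderedInsert, hx, hy, if_true, turnValue]
          split_ifs <;> constructor <;> linarith
        · have key := ih hl' (not_le.1 hy).le
          rw [hc] at key
          simp only [List.orderedInsert, hx, hy, if_true, if_false, turnValue]
          split_ifs <;> constructor <;> linarith
      · have hy : ¬ y ≥ c := fun h => hx (le_trans h hyx)
        have key := ih hl' hyx
        simp only [List.orderedInsert, hx, hy, if_false, turnValue]
        split_ifs <;> constructor <;> linarith

/-- When everybody reports `w`, the turns take the values of the goods in decreasing order. -/
theorem sum_pickingRun_const {I G : Type*} [DecidableEq I] [DecidableEq G]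
    (w : G → ℝ) (i : I) (ts : List I) {R : List G} (hR : R.Nodup) {l : List ℝ}
    (hl : l.Pairwise (· ≥ ·)) (hperm : l.Perm (R.map w)) :
    ∑ g ∈ pickingRun (fun _ => w) ts R i, w g = turnValue i ts l := by
  induction ts generalizing R l with
  | nil => simp [pickingRun, turnValue]
  | cons t ts ih =>
    cases hg : pickBest w R with
    | none =>
      obtain rfl := pickBest_eq_none hg
      obtain rfl : l = [] := by simpa using hperm
      simp [pickingRun, pickBest, turnValue]
    | some g =>
      obtain ⟨hmem, hmax⟩ := pickBest_eq_some hg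
      rw [sum_pickingRun_cons w ts hR i hg]
      have hperm' : l.Perm (w g :: (R.erase g).map w) :=
        hperm.trans ((List.perm_cons_erase hmem).map w)
      cases l with
      | nil => simp at hperm'
      | cons a l =>
        have hag : a = w g := by
          apply le_antisymm
          · obtain ⟨x, hx, rfl⟩ := List.mem_map.1 (hperm.subset List.mem_cons_self)
            exact hmax x hx
          · rcases List.mem_cons.1 (hperm'.symm.subset List.mem_cons_self) with h | h
            · exact h.le
            · exact (List.pairwise_cons.1 hl).1 _ h
        subst hag
        rw [turnValue, ih (hR.erase g) (List.pairwise_cons.1 hl).2 hperm'.cons_inv]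

/-- When everybody reports `w`, giving up a good of larger value for one of smaller value before
the run starts cannot be compensated for during the run. -/
theorem add_sum_pickingRun_erase_le {I G : Type*} [DecidableEq I] [DecidableEq G]
    (w : G → ℝ) (i : I) (ts : List I) {R : List G} (hR : R.Nodup) {g b : G}
    (hg : g ∈ R) (hb : b ∈ R) (hgb : w g ≤ w b) :
    w g + ∑ x ∈ pickingRun (fun _ => w) ts (R.erase g) i, w x ≤
      w b + ∑ x ∈ pickingRun (fun _ => w) ts (R.erase b) i, w x := by
  rcases eq_or_ne g b with rfl | hne
  · exact le_rfl
  let l := (((R.erase g).erase b).map w).insertionSort (· ≥ ·)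
  have hl : l.Pairwise (· ≥ ·) := List.pairwise_insertionSort _ _
  have hperm : l.Perm (((R.erase g).erase b).map w) := List.perm_insertionSort _ _
  have hperm_g : (l.orderedInsert (· ≥ ·) (w b)).Perm ((R.erase g).map w) :=
    (List.perm_orderedInsert _ _ _).trans ((hperm.cons _).trans
      ((List.perm_cons_erase ((List.mem_erase_of_ne hne.symm).2 hb)).map w).symm)
  have hperm_b : (l.orderedInsert (· ≥ ·) (w g)).Perm ((R.erase b).map w) := by
    rw [List.erase_comm] at hperm
    exact (List.perm_orderedInsert _ _ _).trans ((hperm.cons _).trans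
      ((List.perm_cons_erase ((List.mem_erase_of_ne hne).2 hg)).map w).symm)
  rw [sum_pickingRun_const w i ts (hR.erase g) (hl.orderedInsert _ _) hperm_g,
    sum_pickingRun_const w i ts (hR.erase b) (hl.orderedInsert _ _) hperm_b]
  linarith [(turnValue_orderedInsert i ts hl hgb).2]

/-- Against truthful opponents with the same valuation, truthful reporting is optimal for every
picking sequence. -/
theorem sum_pickingRun_update_le {I G : Type*} [DecidableEq I] [DecidableEq G]
    (w w' : G → ℝ) (i : I) (ts : List I) {R : List G} (hR : R.Nodup) :
    ∑ g ∈ pickingRun (Function.update (fun _ => w) i w') ts R i, w g ≤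
      ∑ g ∈ pickingRun (fun _ => w) ts R i, w g := by
  induction ts generalizing R with
  | nil => simp [pickingRun]
  | cons t ts ih =>
    cases hb : pickBest w R with
    | none =>
      obtain rfl := pickBest_eq_none hb
      simp [pickingRun, pickBest]
    | some b =>
      rw [sum_pickingRun_cons (v := fun _ => w) w ts hR i hb]
      by_cases hit : i = t
      · subst hit
        cases hg : pickBest w' R with
        | none =>
          obtain rfl := pickBest_eq_none hg
          simp [pickBest] at hb
        | some g =>
          rw [sum_pickingRun_cons w ts hR i (g := g) (by simpa using hg)]
          obtain ⟨hbmem, hbmax⟩ := pickBest_eq_some hb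
          have hgmem := (pickBest_eq_some hg).1
          have := add_sum_pickingRun_erase_le w i ts hR hgmem hbmem (hbmax g hgmem)
          have := ih (hR.erase g)
          simp only [if_true]
          linarith
      · rw [sum_pickingRun_cons w ts hR i (g := b)
          (by rwa [Function.update_of_ne (Ne.symm hit)])]
        have := ih (hR.erase b)
        linarith

/-- Repeated serial dictatorship (round-robin picking) is Nash strategy-proof
for identical additive valuations: if all `n` agents share the common
(nonnegative) additive valuation `w` and all agents other than `i` report `w`
truthfully, then for every misreport `w'` of agent `i`, the true value of the
bundle agent `i` receives when reporting `w` is at least the true value of the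
bundle it receives when reporting `w'`. -/
theorem round_robin_nash_strategyproof_identical_additive {n m : ℕ} (hn : 0 < n)
    (w : Fin m → ℝ) (hw : ∀ g, 0 ≤ w g) (i : Fin n)
    (w' : Fin m → ℝ) (hw' : ∀ g, 0 ≤ w' g) :
    (∑ g ∈ roundRobin hn (fun _ : Fin n => w) i, w g) ≥
      ∑ g ∈ roundRobin hn (Function.update (fun _ : Fin n => w) i w') i, w g := by
  exact sum_pickingRun_update_le w w' i _ (List.nodup_finRange m)
end

section
/- The serial dictatorship mechanism for single-minded agents is strategy-proof: with agents reporting desired bundles and processed in order of nondecreasing reported bundle size (ties broken by agent index), each agent in turn receiving exactly its reported bundle if all its goods remain unallocated and nothing otherwise, and all leftover goods finally added to the bundle of the last agent in the processing order, no single-minded agent can obtain strictly higher true utility by reporting a desired bundle different from its true one, for any fixed reports of the other agents. -/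
/-- Single-minded valuation with desired bundle `D` and value `c`:
a set is worth `c` if it contains `D`, and `0` otherwise. -/
def smVal {G : Type*} [DecidableEq G] (D : Finset G) (c : ℝ) (S : Finset G) : ℝ :=
  if D ⊆ S then c else 0

/-- Process the agents in the given order, maintaining the set `R` of remaining
goods: at agent `i`'s turn, if its reported bundle `D i` is still entirely
available then `i` receives `D i` (which is removed from `R`), and otherwise
`i` receives nothing; the last agent in the processing order additionally
receives all leftover goods. -/
def sdProcess {n : ℕ} {G : Type*} [DecidableEq G]
    (D : Fin n → Finset G) : List (Fin n) → Finset G → Fin n → Finset G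
  | [], _ => fun _ => ∅
  | [i], R => fun j => if j = i then R else ∅
  | i :: k :: ks, R =>
    if D i ⊆ R then
      fun j => (if j = i then D i else ∅) ∪ sdProcess D (k :: ks) (R \ D i) j
    else sdProcess D (k :: ks) R

/-- The processing order of the serial dictatorship mechanism: agents sorted by
nondecreasing reported bundle size, ties broken by agent index. -/
def sdOrder {n : ℕ} {G : Type*} (D : Fin n → Finset G) : List (Fin n) :=
  (List.finRange n).mergeSort fun a b =>
    decide ((D a).card < (D b).card ∨ ((D a).card = (D b).card ∧ a ≤ b))

/-- The serial dictatorship mechanism for single-minded agents on reported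
desired bundles `D`. -/
def sdMech {n : ℕ} {G : Type*} [Fintype G] [DecidableEq G]
    (D : Fin n → Finset G) : Fin n → Finset G :=
  sdProcess D (sdOrder D) Finset.univ

/-- The goods remaining after the agents of a list have been processed in order. -/
def sdRemaining {n : ℕ} {G : Type*} [DecidableEq G] (D : Fin n → Finset G) :
    List (Fin n) → Finset G → Finset G
  | [], R => R
  | i :: l, R => sdRemaining D l (if D i ⊆ R then R \ D i else R)

section

variable {n : ℕ} {G : Type*} [DecidableEq G]

theorem sdRemaining_append (D : Fin n → Finset G) (p q : List (Fin n)) (R : Finset G) :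
    sdRemaining D (p ++ q) R = sdRemaining D q (sdRemaining D p R) := by
  induction p generalizing R with
  | nil => rfl
  | cons a p ih => simp [sdRemaining, ih]

theorem sdRemaining_subset (D : Fin n → Finset G) (p : List (Fin n)) (R : Finset G) :
    sdRemaining D p R ⊆ R := by
  induction p generalizing R with
  | nil => exact subset_rfl
  | cons a p ih =>
    refine (ih _).trans ?_
    split_ifs
    · exact Finset.sdiff_subset
    · exact subset_rfl

theorem sdRemaining_congr {D D' : Fin n → Finset G} {p : List (Fin n)}
    (h : ∀ j ∈ p, D j = D' j) (R : Finset G) :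
    sdRemaining D p R = sdRemaining D' p R := by
  induction p generalizing R with
  | nil => rfl
  | cons a p ih =>
    simp only [List.mem_cons, forall_eq_or_imp] at h
    simp only [sdRemaining, h.1, ih h.2]

theorem sdProcess_of_notMem (D : Fin n → Finset G) {i : Fin n} {l : List (Fin n)}
    (hi : i ∉ l) (R : Finset G) : sdProcess D l R i = ∅ := by
  induction l generalizing R with
  | nil => rfl
  | cons a l ih =>
    simp only [List.mem_cons, not_or] at hi
    cases l with
    | nil => simp [sdProcess, hi.1]
    | cons b l =>
      simp only [sdProcess]
      split_ifs <;> simp [hi.1, ih hi.2]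

/-- The bundle of an agent in terms of the goods remaining at its turn. -/
theorem sdProcess_append_cons (D : Fin n → Finset G) {i : Fin n} {p q : List (Fin n)}
    (hp : i ∉ p) (hq : i ∉ q) (R : Finset G) :
    sdProcess D (p ++ i :: q) R i =
      if q = [] then sdRemaining D p R
      else if D i ⊆ sdRemaining D p R then D i else ∅ := by
  induction p generalizing R with
  | nil =>
    cases q with
    | nil => simp [sdProcess, sdRemaining]
    | cons b q =>
      simp only [List.nil_append, sdProcess, sdRemaining]
      split_ifs <;> simp_all [sdProcess_of_notMem D hq]
  | cons a p ih =>
    simp only [List.mem_cons, not_or] at hp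
    obtain ⟨b, l, hl⟩ : ∃ b l, p ++ i :: q = b :: l :=
      List.exists_cons_of_ne_nil (by simp)
    have ih := ih hp.2
    simp only [List.cons_append, hl, sdProcess, sdRemaining] at ih ⊢
    by_cases h : D a ⊆ R <;> simp [h, hp.1, ih]

end

/-- Agent `a` has priority over agent `b` under reports `D`. -/
def SdLE {n : ℕ} {G : Type*} (D : Fin n → Finset G) (a b : Fin n) : Prop :=
  (D a).card < (D b).card ∨ ((D a).card = (D b).card ∧ a ≤ b)

section

variable {n : ℕ} {G : Type*}

theorem SdLE.antisymm {D : Fin n → Finset G} {a b : Fin n} (hab : SdLE D a b)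
    (hba : SdLE D b a) : a = b := by
  unfold SdLE at *
  omega

theorem pairwise_sdOrder (D : Fin n → Finset G) : (sdOrder D).Pairwise (SdLE D) := by
  have h := List.pairwise_mergeSort
    (le := fun a b => decide ((D a).card < (D b).card ∨ ((D a).card = (D b).card ∧ a ≤ b)))
    (by intro a b c; simp only [decide_eq_true_eq]; omega)
    (by intro a b; simp only [Bool.or_eq_true, decide_eq_true_eq]; omega) (List.finRange n)
  exact h.imp fun h => of_decide_eq_true h

theorem sdOrder_perm (D : Fin n → Finset G) : (sdOrder D).Perm (List.finRange n) :=
  List.mergeSort_perm _ _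

theorem nodup_sdOrder (D : Fin n → Finset G) : (sdOrder D).Nodup :=
  (sdOrder_perm D).nodup_iff.2 (List.nodup_finRange n)

theorem exists_sdOrder_eq_append_cons (D : Fin n → Finset G) (i : Fin n) :
    ∃ p q, sdOrder D = p ++ i :: q ∧ i ∉ p ∧ i ∉ q := by
  obtain ⟨p, q, h⟩ := List.append_of_mem ((sdOrder_perm D).mem_iff.2 (List.mem_finRange i))
  have hn := nodup_sdOrder D
  rw [h, List.nodup_middle, List.nodup_cons, List.mem_append, not_or] at hn
  exact ⟨p, q, h, hn.1⟩

/-- The relative order of the other agents does not depend on the report of agent `i`. -/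
theorem sdOrder_others_eq {D D' : Fin n → Finset G} {i : Fin n}
    (hDD : ∀ j, j ≠ i → D j = D' j) {p q p' q' : List (Fin n)}
    (h : sdOrder D = p ++ i :: q) (h' : sdOrder D' = p' ++ i :: q')
    (hp : i ∉ p) (hq : i ∉ q) : p ++ q = p' ++ q' := by
  have hperm : (p ++ q).Perm (p' ++ q') := by
    have := (sdOrder_perm D).trans (sdOrder_perm D').symm
    rw [h, h'] at this
    exact (List.perm_middle.symm.trans (this.trans List.perm_middle)).cons_inv
  have hs := pairwise_sdOrder D
  have hs' := pairwise_sdOrder D'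
  rw [h] at hs
  rw [h'] at hs'
  have hs := hs.sublist ((List.sublist_cons_self i q).append_left p)
  have hs' := hs'.sublist ((List.sublist_cons_self i q').append_left p')
  have hne : ∀ j ∈ p ++ q, j ≠ i := by
    rintro j hj rfl
    simp [hp, hq] at hj
  have hs' : (p' ++ q').Pairwise (SdLE D) := by
    refine hs'.imp_of_mem fun {a b} ha hb hab => ?_
    have ha := hDD a (hne a (hperm.mem_iff.2 ha))
    have hb := hDD b (hne b (hperm.mem_iff.2 hb))
    simpa only [SdLE, ha, hb] using hab
  exact hperm.eq_of_pairwise (fun _ _ _ _ => SdLE.antisymm) hs hs'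

end

/-- The serial dictatorship mechanism for single-minded agents is
strategy-proof: for any fixed (nonempty) reports of the other agents, a
single-minded agent `i` with true nonempty desired bundle `D i` and value
`c i > 0` obtains at least as much true utility by reporting `D i` truthfully
as by reporting any other nonempty bundle (`reports i`). -/
theorem serial_dictatorship_single_minded_strategyproof
    {n : ℕ} {G : Type*} [Fintype G] [DecidableEq G]
    (D : Fin n → Finset G) (hD : ∀ i, (D i).Nonempty)
    (c : Fin n → ℝ) (hc : ∀ i, 0 < c i)
    (reports : Fin n → Finset G) (hreports : ∀ j, (reports j).Nonempty)
    (i : Fin n) :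
    smVal (D i) (c i) (sdMech (Function.update reports i (D i)) i) ≥
      smVal (D i) (c i) (sdMech reports i) := by
  set T := Function.update reports i (D i) with hT
  have hTi : T i = D i := by simp [hT]
  have hTj : ∀ j, j ≠ i → reports j = T j := fun j hj => by simp [hT, hj]
  suffices h : D i ⊆ sdMech reports i → D i ⊆ sdMech T i by
    unfold smVal
    split_ifs with h₁ h₂ h₂
    · exact le_rfl
    · exact (hc i).le
    · exact absurd (h h₂) h₁
    · exact le_rfl
  intro hwin
  obtain ⟨p, q, ho, hp, hq⟩ := exists_sdOrder_eq_append_cons reports i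
  obtain ⟨p', q', ho', hp', hq'⟩ := exists_sdOrder_eq_append_cons T i
  have heq := sdOrder_others_eq hTj ho ho' hp hq
  rw [sdMech, ho, sdProcess_append_cons _ hp hq] at hwin
  rw [sdMech, ho', sdProcess_append_cons _ hp' hq', hTi]
  have hsub : D i ⊆ sdRemaining reports p Finset.univ ∧ (q ≠ [] → D i ⊆ reports i) := by
    split_ifs at hwin with h₁ h₂
    · exact ⟨hwin, fun h => absurd h₁ h⟩
    · exact ⟨hwin.trans h₂, fun _ => hwin⟩
    · exact absurd (Finset.subset_empty.1 hwin) (hD i).ne_empty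
  have hprefix : p' <+: p := by
    rcases List.append_eq_append_iff.1 heq with ⟨t, rfl, rfl⟩ | ⟨t, rfl, -⟩
    · cases t with
      | nil => simp
      | cons j t =>
        have hcard := Finset.card_le_card (hsub.2 (by simp))
        have hji : j ≠ i := by rintro rfl; simp at hq
        have hij : SdLE reports i j := by
          have := pairwise_sdOrder reports
          rw [ho, List.pairwise_append, List.pairwise_cons] at this
          exact this.2.1.1 j (by simp)
        have hji' : SdLE T j i := by
          have := pairwise_sdOrder T
          rw [ho', List.pairwise_append] at this
          exact this.2.2 j (by simp) i (by simp)
        refine absurd (hji'.antisymm ?_) hji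
        unfold SdLE at hij ⊢
        rw [hTi, ← hTj j hji]
        omega
    · exact List.prefix_append _ _
  have hrem : D i ⊆ sdRemaining T p' Finset.univ := by
    obtain ⟨t, rfl⟩ := hprefix
    have h := hsub.1
    rw [sdRemaining_append] at h
    rw [← sdRemaining_congr fun j hj => hTj j (by rintro rfl; exact hp' hj)]
    exact h.trans (sdRemaining_subset _ _ _)
  split_ifs
  · exact hrem
  · exact subset_rfl
end

section
/- For two agents with additive valuations in which every good has strictly positive value to both agents, every MMS complete allocation is EFX: if A is a complete allocation with v_i(A_i) >= mu_i for i = 1, 2, then for all agents i, j and every good a in A_j, v_i(A_i) >= v_i(A_j \ {a}). -/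
/-- The bundle of goods assigned to index `j` by the assignment `P`. -/
def bundleOf {G : Type*} [Fintype G] {n : ℕ} [DecidableEq G]
    (P : G → Fin n) (j : Fin n) : Finset G :=
  Finset.univ.filter fun g => P g = j

theorem bundleOf_update_self {G : Type*} [Fintype G] [DecidableEq G] {n : ℕ}
    (A : G → Fin n) (a : G) (i : Fin n) :
    bundleOf (Function.update A a i) i = insert a (bundleOf A i) := by
  ext g
  by_cases h : g = a <;> simp [bundleOf, Function.update_apply, h]

theorem bundleOf_update_of_ne {G : Type*} [Fintype G] [DecidableEq G] {n : ℕ}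
    (A : G → Fin n) (a : G) {i j : Fin n} (hij : i ≠ j) :
    bundleOf (Function.update A a i) j = (bundleOf A j).erase a := by
  ext g
  by_cases h : g = a <;> simp [bundleOf, Function.update_apply, h, hij]

/-- The minimum over the two bundles is the minimum over any two distinct indices. -/
theorem min_fin_two_of_ne (f : Fin 2 → ℝ) {i j : Fin 2} (hij : i ≠ j) :
    min (f 0) (f 1) = min (f i) (f j) := by
  fin_cases i <;> fin_cases j <;> simp_all [min_comm]

/-- For two agents with additive valuations in which every good has strictly
positive value to both agents, every MMS complete allocation is EFX: if each
agent's bundle value is at least its maximin share (the maximum over all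
partitions `(P_0, P_1)` of the goods of `min (v_i(P_0)) (v_i(P_1))`), then for
all agents `i, j` and every good `a ∈ A_j`, `v_i(A_i) ≥ v_i(A_j \ {a})`. -/
theorem mms_implies_efx_two_agents
    {G : Type*} [Fintype G] [DecidableEq G]
    (v : Fin 2 → G → ℝ) (hv : ∀ i g, 0 < v i g)
    (A : G → Fin 2)
    (hMMS : ∀ i : Fin 2,
      (∑ g ∈ bundleOf A i, v i g) ≥
        Finset.univ.sup'
          (⟨fun _ => 0, Finset.mem_univ _⟩ :
            (Finset.univ : Finset (G → Fin 2)).Nonempty)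
          fun P => min (∑ g ∈ bundleOf P 0, v i g) (∑ g ∈ bundleOf P 1, v i g)) :
    ∀ i j : Fin 2, ∀ a ∈ bundleOf A j,
      (∑ g ∈ bundleOf A i, v i g) ≥ ∑ g ∈ (bundleOf A j).erase a, v i g := by
  intro i j a ha
  rcases eq_or_ne i j with rfl | hij
  · exact Finset.sum_le_sum_of_subset_of_nonneg (Finset.erase_subset _ _)
      fun g _ _ => (hv i g).le
  · have hle := (Finset.le_sup' (fun P : G → Fin 2 =>
      min (∑ g ∈ bundleOf P 0, v i g) (∑ g ∈ bundleOf P 1, v i g))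
      (Finset.mem_univ (Function.update A a i))).trans (hMMS i)
    have haj : A a = j := by simpa [bundleOf] using ha
    have hai : a ∉ bundleOf A i := by simpa [bundleOf, haj] using hij.symm
    rw [min_fin_two_of_ne (fun k => ∑ g ∈ bundleOf (Function.update A a i) k, v i g) hij,
      bundleOf_update_self, bundleOf_update_of_ne A a hij, Finset.sum_insert hai] at hle
    exact (min_le_iff.mp hle).resolve_left (by linarith [hv i a])
end
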